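/- arXiv:2210.15290 — 2 statements merged into one kernel-verified Lean document; each statement's English description precedes it below -/
import Mathlib

section
/- Let π be the spectral scaled Student prior on ℝ^{p×m} with density proportional to det(τ²I_m + M Mᵀ)^{−(p+m+2)/2}. Then ∫ ‖M‖_F² π(dM) ≤ p·m·τ². -/
open MeasureTheory Matrix Finset
open scoped ENNReal

lemma radial_deriv (p m : ℕ) (hm : 0 < m) (r : ℝ) :
    HasDerivAt (fun r : ℝ => r ^ m * (1 + r ^ 2) ^ (-((p : ℝ) + m) / 2))
      (m * (r ^ (m - 1) * (1 + r ^ 2) ^ (-((p : ℝ) + m + 2) / 2))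
        - p * (r ^ (m - 1) * (r ^ 2 * (1 + r ^ 2) ^ (-((p : ℝ) + m + 2) / 2)))) r := by
  have hpos : (0:ℝ) < 1 + r ^ 2 := by positivity
  have h1 : HasDerivAt (fun r : ℝ => 1 + r ^ 2) (2 * r) r := by
    simpa using ((hasDerivAt_pow 2 r).const_add 1)
  have h2 := h1.rpow_const (p := -((p : ℝ) + m) / 2) (Or.inl hpos.ne')
  have h3 := (hasDerivAt_pow m r).mul h2
  refine h3.congr_deriv ?_
  have e1 : -((p : ℝ) + m) / 2 - 1 = -((p : ℝ) + m + 2) / 2 := by ring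
  have e2 : (1 + r ^ 2) ^ (-((p : ℝ) + m) / 2)
      = (1 + r ^ 2) * (1 + r ^ 2) ^ (-((p : ℝ) + m + 2) / 2) := by
    rw [← Real.rpow_one_add' hpos.le]
    · congr 1; ring
    · have : (0:ℝ) < m := by exact_mod_cast hm
      have : (0:ℝ) ≤ p := by positivity
      intro h; linarith
  rw [e1, e2]
  obtain ⟨k, rfl⟩ : ∃ k, m = k + 1 := ⟨m - 1, by omega⟩
  simp only [Nat.add_sub_cancel]
  push_cast
  ring

lemma radial_tendsto (p m : ℕ) (hp : 0 < p) :
    Filter.Tendsto (fun r : ℝ => r ^ m * (1 + r ^ 2) ^ (-((p : ℝ) + m) / 2))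
      Filter.atTop (nhds 0) := by
  have hp' : (0:ℝ) < p := by exact_mod_cast hp
  refine squeeze_zero' (g := fun r : ℝ => r ^ (-(p:ℝ))) ?_ ?_ (tendsto_rpow_neg_atTop hp')
  · filter_upwards [Filter.eventually_gt_atTop 0] with r hr
    positivity
  · filter_upwards [Filter.eventually_gt_atTop 0] with r hr
    have : (1 + r ^ 2) ^ (-((p : ℝ) + m) / 2) ≤ (r ^ 2) ^ (-((p : ℝ) + m) / 2) := by
      apply Real.rpow_le_rpow_of_nonpos (by positivity) (by linarith)
      have : (0:ℝ) ≤ m := by positivity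
      linarith
    calc _ ≤ r ^ m * (r ^ 2) ^ (-((p : ℝ) + m) / 2) := by gcongr
      _ = _ := by
        rw [← Real.rpow_natCast r m, ← Real.rpow_natCast r 2, ← Real.rpow_mul hr.le,
          ← Real.rpow_add hr]
        congr 1; push_cast; ring

lemma radial_eucl (p m : ℕ) (hp : 0 < p) (hm : 0 < m) :
    Integrable (fun x : EuclideanSpace ℝ (Fin m) =>
      (1 + ‖x‖ ^ 2) ^ (-((p : ℝ) + m + 2) / 2)) ∧
    Integrable (fun x : EuclideanSpace ℝ (Fin m) =>
      ‖x‖ ^ 2 * (1 + ‖x‖ ^ 2) ^ (-((p : ℝ) + m + 2) / 2)) ∧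
    (p : ℝ) * ∫ x : EuclideanSpace ℝ (Fin m),
      ‖x‖ ^ 2 * (1 + ‖x‖ ^ 2) ^ (-((p : ℝ) + m + 2) / 2)
      = m * ∫ x : EuclideanSpace ℝ (Fin m), (1 + ‖x‖ ^ 2) ^ (-((p : ℝ) + m + 2) / 2) := by
  have hp' : (0:ℝ) < p := by exact_mod_cast hp
  have hm' : (0:ℝ) < m := by exact_mod_cast hm
  have i1 : Integrable (fun x : EuclideanSpace ℝ (Fin m) =>
      (1 + ‖x‖ ^ 2) ^ (-((p : ℝ) + m + 2) / 2)) :=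
    integrable_rpow_neg_one_add_norm_sq (by simp; linarith)
  have i0 : Integrable (fun x : EuclideanSpace ℝ (Fin m) =>
      (1 + ‖x‖ ^ 2) ^ (-((p : ℝ) + m) / 2)) :=
    integrable_rpow_neg_one_add_norm_sq (by simp; linarith)
  have i2 : Integrable (fun x : EuclideanSpace ℝ (Fin m) =>
      ‖x‖ ^ 2 * (1 + ‖x‖ ^ 2) ^ (-((p : ℝ) + m + 2) / 2)) := by
    refine (i0.sub i1).congr (Filter.Eventually.of_forall fun x => ?_)
    have hpos : (0:ℝ) < 1 + ‖x‖ ^ 2 := by positivity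
    have e2 : (1 + ‖x‖ ^ 2) ^ (-((p : ℝ) + m) / 2)
      = (1 + ‖x‖ ^ 2) * (1 + ‖x‖ ^ 2) ^ (-((p : ℝ) + m + 2) / 2) := by
      rw [← Real.rpow_one_add' hpos.le]
      · congr 1; ring
      · intro h; linarith
    simp only [Pi.sub_apply, e2]
    ring
  have : Nonempty (Fin m) := ⟨⟨0, hm⟩⟩
  refine ⟨i1, i2, ?_⟩
  have j1 := (integrable_fun_norm_addHaar (volume : Measure (EuclideanSpace ℝ (Fin m)))
    (f := fun r : ℝ => (1 + r ^ 2) ^ (-((p : ℝ) + m + 2) / 2))).1 i1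
  have j2 := (integrable_fun_norm_addHaar (volume : Measure (EuclideanSpace ℝ (Fin m)))
    (f := fun r : ℝ => r ^ 2 * (1 + r ^ 2) ^ (-((p : ℝ) + m + 2) / 2))).1 i2
  rw [integral_fun_norm_addHaar (volume : Measure (EuclideanSpace ℝ (Fin m)))
    (fun r : ℝ => (1 + r ^ 2) ^ (-((p : ℝ) + m + 2) / 2)),
    integral_fun_norm_addHaar (volume : Measure (EuclideanSpace ℝ (Fin m)))
    (fun r : ℝ => r ^ 2 * (1 + r ^ 2) ^ (-((p : ℝ) + m + 2) / 2))]
  simp only [finrank_euclideanSpace, Fintype.card_fin, smul_eq_mul, nsmul_eq_mul] at j1 j2 ⊢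
  have key := integral_Ioi_of_hasDerivAt_of_tendsto' (a := (0:ℝ))
    (fun x _ => radial_deriv p m hm x)
    ((Integrable.const_mul j1 (m:ℝ)).sub (Integrable.const_mul j2 (p:ℝ))) (radial_tendsto p m hp)
  rw [integral_sub (Integrable.const_mul j1 (m:ℝ)) (Integrable.const_mul j2 (p:ℝ)),
    integral_const_mul, integral_const_mul] at key
  simp only [zero_pow hm.ne', zero_mul, sub_zero] at key
  linear_combination (-(m * (volume : Measure (EuclideanSpace ℝ (Fin m))).real (Metric.ball 0 1))) * key

lemma radial_lintegral (p m : ℕ) (hp : 0 < p) (hm : 0 < m) :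
    (p : ℝ≥0∞) * ∫⁻ y : Fin m → ℝ, ENNReal.ofReal (∑ j, y j ^ 2)
        * ENNReal.ofReal ((1 + ∑ j, y j ^ 2) ^ (-((p : ℝ) + m + 2) / 2))
      = m * ∫⁻ y : Fin m → ℝ, ENNReal.ofReal ((1 + ∑ j, y j ^ 2) ^ (-((p : ℝ) + m + 2) / 2)) := by
  obtain ⟨i1, i2, h⟩ := radial_eucl p m hp hm
  have n (y : Fin m → ℝ) : ∑ j, y j ^ 2 = ‖WithLp.toLp 2 y‖ ^ 2 := by
    simp [EuclideanSpace.norm_sq_eq]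
  have c := (PiLp.volume_preserving_toLp (Fin m))
  have em := (MeasurableEquiv.toLp 2 (Fin m → ℝ)).measurableEmbedding
  simp only [n]
  have e1 := c.lintegral_comp_emb em (fun x => ENNReal.ofReal ((1 + ‖x‖ ^ 2) ^ (-((p : ℝ) + m + 2) / 2)))
  have e2 := c.lintegral_comp_emb em (fun x => ENNReal.ofReal (‖x‖^2) * ENNReal.ofReal ((1 + ‖x‖ ^ 2) ^ (-((p : ℝ) + m + 2) / 2)))
  rw [e1, e2]
  simp_rw [← ENNReal.ofReal_mul (sq_nonneg _)]
  rw [← ofReal_integral_eq_lintegral_ofReal i1 (Filter.Eventually.of_forall fun x => by positivity),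
    ← ofReal_integral_eq_lintegral_ofReal i2 (Filter.Eventually.of_forall fun x => by positivity),
    ← ENNReal.ofReal_natCast, ← ENNReal.ofReal_natCast, ← ENNReal.ofReal_mul (by positivity),
    ← ENNReal.ofReal_mul (by positivity), h]

lemma coord_lintegral (p m : ℕ) (hp : 0 < p) (hm : 0 < m) (k : Fin m) :
    (p : ℝ≥0∞) * ∫⁻ y : Fin m → ℝ, ENNReal.ofReal (y k ^ 2)
        * ENNReal.ofReal ((1 + ∑ j, y j ^ 2) ^ (-((p : ℝ) + m + 2) / 2))
      = ∫⁻ y : Fin m → ℝ, ENNReal.ofReal ((1 + ∑ j, y j ^ 2) ^ (-((p : ℝ) + m + 2) / 2)) := by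
  have sym (l : Fin m) : ∫⁻ y : Fin m → ℝ, ENNReal.ofReal (y l ^ 2)
        * ENNReal.ofReal ((1 + ∑ j, y j ^ 2) ^ (-((p : ℝ) + m + 2) / 2)) =
      ∫⁻ y : Fin m → ℝ, ENNReal.ofReal (y k ^ 2)
        * ENNReal.ofReal ((1 + ∑ j, y j ^ 2) ^ (-((p : ℝ) + m + 2) / 2)) := by
    have c := volume_measurePreserving_piCongrLeft (fun _ : Fin m => ℝ) (Equiv.swap k l)
    rw [← c.lintegral_comp_emb (MeasurableEquiv.measurableEmbedding _)]
    congr 1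
    ext y
    have e (j : Fin m) : (MeasurableEquiv.piCongrLeft (fun _ : Fin m => ℝ) (Equiv.swap k l)) y j
        = y (Equiv.swap k l j) := by
      conv_lhs => rw [← Equiv.apply_symm_apply (Equiv.swap k l) j]
      rw [MeasurableEquiv.coe_piCongrLeft, Equiv.piCongrLeft_apply_apply]
      simp
    simp only [e, Equiv.swap_apply_right]
    rw [Equiv.sum_comp (Equiv.swap k l) (fun j => y j ^ 2)]
  have h := radial_lintegral p m hp hm
  have s : ∫⁻ y : Fin m → ℝ, ENNReal.ofReal (∑ j, y j ^ 2)
        * ENNReal.ofReal ((1 + ∑ j, y j ^ 2) ^ (-((p : ℝ) + m + 2) / 2)) =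
      m * ∫⁻ y : Fin m → ℝ, ENNReal.ofReal (y k ^ 2)
        * ENNReal.ofReal ((1 + ∑ j, y j ^ 2) ^ (-((p : ℝ) + m + 2) / 2)) := by
    simp_rw [ENNReal.ofReal_sum_of_nonneg (fun i (_ : i ∈ Finset.univ) => sq_nonneg _),
      Finset.sum_mul]
    rw [lintegral_finsetSum]
    · rw [Finset.sum_congr rfl (fun l _ => sym l)]
      simp
    · intro i _
      fun_prop
  rw [s, mul_left_comm] at h
  exact (ENNReal.mul_right_inj (by exact_mod_cast hm.ne') (by simp)).1 h

lemma exists_factor {m : ℕ} (B : Matrix (Fin m) (Fin m) ℝ) (hB : B.PosDef) :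
    ∃ (C : Matrix (Fin m) (Fin m) ℝ) (d : Fin m → ℝ), (∀ i, 0 < d i) ∧ B = C * Cᵀ ∧
      Cᵀ * C = diagonal d := by
  have hd := hB.eigenvalues_pos
  set d := hB.1.eigenvalues with hdd
  set U : Matrix (Fin m) (Fin m) ℝ := (hB.1.eigenvectorUnitary : Matrix (Fin m) (Fin m) ℝ) with hU
  have hUU : Uᵀ * U = 1 := by
    have := Unitary.coe_star_mul_self hB.1.eigenvectorUnitary
    simpa [star_eq_conjTranspose] using this
  have hs : diagonal (fun i => √(d i)) * diagonal (fun i => √(d i)) = diagonal d := by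
    rw [diagonal_mul_diagonal]
    congr 1; ext i; exact Real.mul_self_sqrt (hd i).le
  refine ⟨U * diagonal (fun i => √(d i)), d, hd, ?_, ?_⟩
  · have := hB.1.spectral_theorem
    rw [Unitary.conjStarAlgAut_apply] at this
    rw [transpose_mul, diagonal_transpose, Matrix.mul_assoc, ← Matrix.mul_assoc (diagonal _), hs]
    rw [← Matrix.mul_assoc]
    conv_lhs => rw [this]
    simp [star_eq_conjTranspose, hU, hdd, Function.comp_def]
  · rw [transpose_mul, diagonal_transpose, Matrix.mul_assoc, ← Matrix.mul_assoc Uᵀ, hUU,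
      Matrix.one_mul, hs]

lemma key_row (p m : ℕ) (hp : 0 < p) (hm : 0 < m) (B : Matrix (Fin m) (Fin m) ℝ) (hB : B.PosDef) :
    (p : ℝ≥0∞) * ∫⁻ x : Fin m → ℝ, ENNReal.ofReal (∑ j, x j ^ 2)
        * ENNReal.ofReal ((B + vecMulVec x x).det ^ (-((p : ℝ) + m + 2) / 2))
      = ENNReal.ofReal B.trace * ∫⁻ x : Fin m → ℝ,
        ENNReal.ofReal ((B + vecMulVec x x).det ^ (-((p : ℝ) + m + 2) / 2)) := by
  obtain ⟨C, d, hd, rfl, hC⟩ := exists_factor B hB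
  have hdet : C.det ≠ 0 := by
    have := hB.det_pos
    rw [det_mul] at this
    intro h; simp [h] at this
  have hmap := Real.map_matrix_volume_pi_eq_smul_volume_pi hdet
  set c := ENNReal.ofReal (|(C.det)⁻¹|) with hc
  have hc0 : c ≠ 0 := by simp [hc, hdet]
  have hct : c ≠ ∞ := by simp [hc]
  -- change of variables
  have cv (F : (Fin m → ℝ) → ℝ≥0∞) (hF : Measurable F) :
      c * ∫⁻ x, F x = ∫⁻ y, F (C *ᵥ y) := by
    rw [← smul_eq_mul, ← lintegral_smul_measure, ← hmap, lintegral_map hF]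
    · rfl
    · exact (LinearMap.continuous_of_finiteDimensional (toLin' C)).measurable
  have hdetx (y : Fin m → ℝ) : (C * Cᵀ + vecMulVec (C *ᵥ y) (C *ᵥ y)).det
      = (C * Cᵀ).det * (1 + ∑ j, y j ^ 2) := by
    have : C * Cᵀ + vecMulVec (C *ᵥ y) (C *ᵥ y)
        = C * (1 + replicateCol Unit y * replicateRow Unit y) * Cᵀ := by
      rw [← vecMulVec_eq, Matrix.mul_add, Matrix.add_mul, Matrix.mul_one, mul_vecMulVec,
        vecMulVec_mul, vecMul_transpose]
    rw [this, det_mul, det_mul, det_one_add_replicateCol_mul_replicateRow, det_mul]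
    simp only [dotProduct, ← sq]
    ring
  have hnorm (y : Fin m → ℝ) : ∑ j, (C *ᵥ y) j ^ 2 = ∑ k, d k * y k ^ 2 := by
    have : (C *ᵥ y) ⬝ᵥ (C *ᵥ y) = y ⬝ᵥ ((Cᵀ * C) *ᵥ y) := by
      rw [← mulVec_mulVec, dotProduct_mulVec y, vecMul_transpose]
    rw [hC] at this
    simp only [dotProduct, ← sq, mulVec_diagonal] at this
    rw [this]
    exact Finset.sum_congr rfl fun k _ => by ring
  have htr : (C * Cᵀ).trace = ∑ k, d k := by
    rw [trace_mul_comm, hC, trace_diagonal]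
  have hdm : Measurable fun x : Fin m → ℝ => (C * Cᵀ + vecMulVec x x).det := by
    apply Continuous.measurable
    apply Continuous.matrix_det
    apply continuous_matrix
    intro i j
    simp only [Matrix.add_apply, vecMulVec_apply]
    fun_prop
  rw [← ENNReal.mul_right_inj hc0 hct, mul_left_comm, mul_left_comm c, cv _ (by fun_prop),
    cv _ (by fun_prop)]
  simp only [hnorm, hdetx, htr]
  have hD := hB.det_pos
  have e (y : Fin m → ℝ) : ENNReal.ofReal (((C * Cᵀ).det * (1 + ∑ j, y j ^ 2)) ^ (-((p : ℝ) + m + 2) / 2))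
     = ENNReal.ofReal ((C * Cᵀ).det ^ (-((p : ℝ) + m + 2) / 2)) *
      ENNReal.ofReal ((1 + ∑ j, y j ^ 2) ^ (-((p : ℝ) + m + 2) / 2)) := by
    rw [Real.mul_rpow hD.le (by positivity), ENNReal.ofReal_mul (by positivity)]
  simp_rw [e, mul_left_comm (ENNReal.ofReal (∑ k, d k * _))]
  rw [lintegral_const_mul _ (by fun_prop), lintegral_const_mul _ (by fun_prop), mul_left_comm,
    mul_left_comm (ENNReal.ofReal (∑ k, d k))]
  congr 1
  simp_rw [ENNReal.ofReal_sum_of_nonneg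
    (fun i (_ : i ∈ Finset.univ) => mul_nonneg (hd i).le (sq_nonneg _)),
      Finset.sum_mul]
  rw [lintegral_finsetSum _ (fun i _ => by fun_prop),
    ENNReal.ofReal_sum_of_nonneg (fun i _ => (hd i).le), Finset.sum_mul, Finset.mul_sum]
  refine Finset.sum_congr rfl fun k _ => ?_
  simp_rw [ENNReal.ofReal_mul (hd k).le, mul_assoc]
  rw [lintegral_const_mul _ (by fun_prop), mul_left_comm, coord_lintegral p m hp hm k]

lemma rows_sum {p m : ℕ} (M : Fin p → Fin m → ℝ) :
    (Matrix.of M)ᵀ * Matrix.of M = ∑ i, vecMulVec (M i) (M i) := by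
  ext a b
  simp [Matrix.mul_apply, Matrix.sum_apply, vecMulVec_apply]

lemma posDef_B {n m : ℕ} (τ : ℝ) (hτ : 0 < τ) (R : Fin n → Fin m → ℝ) :
    (τ ^ 2 • (1 : Matrix (Fin m) (Fin m) ℝ) + (Matrix.of R)ᵀ * Matrix.of R).PosDef := by
  refine Matrix.PosDef.add_posSemidef ?_ ?_
  · exact Matrix.PosDef.one.smul (by positivity)
  · simpa using Matrix.posSemidef_conjTranspose_mul_self (Matrix.of R)

lemma trace_B {n m : ℕ} (τ : ℝ) (R : Fin n → Fin m → ℝ) :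
    (τ ^ 2 • (1 : Matrix (Fin m) (Fin m) ℝ) + (Matrix.of R)ᵀ * Matrix.of R).trace
      = m * τ ^ 2 + ∑ k, ∑ j, R k j ^ 2 := by
  rw [trace_add, rows_sum, trace_sum]
  simp [trace_vecMulVec, dotProduct, ← sq, mul_comm]

lemma measurable_f {p m : ℕ} (τ : ℝ) (f : (Fin p → Fin m → ℝ) → ℝ)
    (hf : ∀ M, f M = Matrix.det (τ ^ 2 • (1 : Matrix (Fin m) (Fin m) ℝ)
        + (Matrix.of M)ᵀ * Matrix.of M) ^ (-((p : ℝ) + m + 2) / 2)) : Measurable f := by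
  rw [funext hf]
  refine Measurable.pow_const ?_ _
  apply Continuous.measurable
  apply Continuous.matrix_det
  apply continuous_matrix
  intro i j
  simp only [Matrix.add_apply, Matrix.mul_apply, transpose_apply, of_apply]
  fun_prop

lemma row_identity {n m : ℕ} (hm : 0 < m) (τ : ℝ) (hτ : 0 < τ)
    (f : (Fin (n+1) → Fin m → ℝ) → ℝ)
    (hf : ∀ M, f M = Matrix.det (τ ^ 2 • (1 : Matrix (Fin m) (Fin m) ℝ)
        + (Matrix.of M)ᵀ * Matrix.of M) ^ (-(((n+1 : ℕ) : ℝ) + m + 2) / 2)) (i : Fin (n+1)) :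
    ((n+1 : ℕ) : ℝ≥0∞) * ∫⁻ M, ENNReal.ofReal (∑ j, M i j ^ 2) * ENNReal.ofReal (f M)
      = ∫⁻ M, ENNReal.ofReal (m * τ ^ 2 + ∑ k, ∑ j, M (i.succAbove k) j ^ 2) *
        ENNReal.ofReal (f M) := by
  have mf := measurable_f τ f hf
  have c := (volume_preserving_piFinSuccAbove (fun _ : Fin (n+1) => (Fin m → ℝ)) i).symm
  have em := (MeasurableEquiv.piFinSuccAbove (fun _ : Fin (n+1) => (Fin m → ℝ)) i).symm.measurableEmbedding
  have split (F : (Fin (n+1) → Fin m → ℝ) → ℝ≥0∞) (hF : Measurable F) :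
      ∫⁻ M, F M = ∫⁻ R : Fin n → Fin m → ℝ, ∫⁻ x : Fin m → ℝ, F (i.insertNth x R) := by
    rw [← c.lintegral_comp_emb em F]
    exact lintegral_prod_symm' _ (hF.comp em.measurable)
  have hfi (x : Fin m → ℝ) (R : Fin n → Fin m → ℝ) : f (i.insertNth x R)
      = ((τ ^ 2 • (1 : Matrix (Fin m) (Fin m) ℝ) + (Matrix.of R)ᵀ * Matrix.of R)
        + vecMulVec x x).det ^ (-(((n+1 : ℕ) : ℝ) + m + 2) / 2) := by
    rw [hf, rows_sum, Fin.sum_univ_succAbove _ i, rows_sum]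
    simp only [Fin.insertNth_apply_same, Fin.insertNth_apply_succAbove]
    congr 2
    abel
  have mfi (R : Fin n → Fin m → ℝ) : Measurable fun x : Fin m → ℝ => f (i.insertNth x R) := by
    apply mf.comp
    exact em.measurable.comp (measurable_prodMk_right (y := R))
  rw [← lintegral_const_mul _ (by fun_prop), split _ (by fun_prop), split _ (by fun_prop)]
  congr 1
  ext R
  simp only [Fin.insertNth_apply_same, Fin.insertNth_apply_succAbove]
  have := mfi R
  rw [lintegral_const_mul _ (by fun_prop), lintegral_const_mul _ (by fun_prop)]
  simp only [hfi]
  rw [key_row (n+1) m (by omega) hm _ (posDef_B τ hτ R), trace_B]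

lemma total {n m : ℕ} (hm : 0 < m) (τ : ℝ) (hτ : 0 < τ)
    (f : (Fin (n+1) → Fin m → ℝ) → ℝ)
    (hf : ∀ M, f M = Matrix.det (τ ^ 2 • (1 : Matrix (Fin m) (Fin m) ℝ)
        + (Matrix.of M)ᵀ * Matrix.of M) ^ (-(((n+1 : ℕ) : ℝ) + m + 2) / 2))
    (hfin : ∫⁻ M, ENNReal.ofReal (∑ i, ∑ j, M i j ^ 2) * ENNReal.ofReal (f M) ≠ ∞) :
    ∫⁻ M, ENNReal.ofReal (∑ i, ∑ j, M i j ^ 2) * ENNReal.ofReal (f M)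
      = ENNReal.ofReal (((n+1 : ℕ) : ℝ) * m * τ ^ 2) * ∫⁻ M, ENNReal.ofReal (f M) := by
  have mf := measurable_f τ f hf
  set T : Fin (n+1) → ℝ≥0∞ := fun i => ∫⁻ M, ENNReal.ofReal (∑ j, M i j ^ 2) * ENNReal.ofReal (f M)
  set S := ∫⁻ M, ENNReal.ofReal (∑ i, ∑ j, M i j ^ 2) * ENNReal.ofReal (f M) with hS
  set Z := ∫⁻ M, ENNReal.ofReal (f M) with hZ
  have hST : S = ∑ i, T i := by
    rw [hS]
    simp_rw [ENNReal.ofReal_sum_of_nonneg (fun i (_ : i ∈ (Finset.univ : Finset (Fin (n+1)))) =>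
      Finset.sum_nonneg fun j (_ : j ∈ (Finset.univ : Finset (Fin m))) => sq_nonneg _),
      Finset.sum_mul]
    exact lintegral_finsetSum _ (fun i _ => by fun_prop)
  have h1 (i : Fin (n+1)) : ((n+1 : ℕ) : ℝ≥0∞) * T i + T i = ENNReal.ofReal (m * τ ^ 2) * Z + S := by
    have := row_identity hm τ hτ f hf i
    rw [show T i = ∫⁻ M, ENNReal.ofReal (∑ j, M i j ^ 2) * ENNReal.ofReal (f M) from rfl, this,
      hS, hZ, ← lintegral_const_mul _ (by fun_prop), ← lintegral_add_left (by fun_prop),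
      ← lintegral_add_left (by fun_prop)]
    congr 1
    ext M
    rw [← add_mul, ← add_mul]
    congr 1
    rw [← ENNReal.ofReal_add (by positivity) (by positivity),
      ← ENNReal.ofReal_add (by positivity) (by positivity), Fin.sum_univ_succAbove _ i]
    congr 1
    ring
  have h2 : ((n+1 : ℕ) : ℝ≥0∞) * S + S = ENNReal.ofReal (((n+1 : ℕ) : ℝ) * m * τ ^ 2) * Z
      + ((n+1 : ℕ) : ℝ≥0∞) * S := by
    have h3 : ∑ i, (((n+1 : ℕ) : ℝ≥0∞) * T i + T i) = ∑ i : Fin (n+1), (ENNReal.ofReal (m * τ ^ 2) * Z + S) :=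
      Finset.sum_congr rfl fun i _ => h1 i
    rw [Finset.sum_add_distrib, ← Finset.mul_sum, ← hST] at h3
    rw [h3, mul_assoc ((n+1 : ℕ) : ℝ), ENNReal.ofReal_mul (p := ((n+1 : ℕ) : ℝ)) (by positivity),
      ENNReal.ofReal_natCast]
    simp only [Finset.sum_const, Finset.card_univ, Fintype.card_fin, nsmul_eq_mul]
    ring
  rw [add_comm] at h2
  exact (ENNReal.add_left_inj (ENNReal.mul_ne_top (by simp) hfin)).1 h2

/-- **Second moment of the spectral scaled Student prior** (Dalalyan, Lemma 1):
for the prior on `p × m` real matrices with density proportional to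
`det(τ² I_m + M Mᵀ)^{-(p+m+2)/2}`, one has `∫ ‖M‖_F² π(dM) ≤ p m τ²`. -/
theorem scaled_student_second_moment
    {p m : ℕ} (hp : 0 < p) (hm : 0 < m) (τ : ℝ) (hτ : 0 < τ)
    (f : (Fin p → Fin m → ℝ) → ℝ)
    (hf : ∀ M, f M = Matrix.det (τ ^ 2 • (1 : Matrix (Fin m) (Fin m) ℝ)
        + (Matrix.of M)ᵀ * Matrix.of M) ^ (-((p : ℝ) + m + 2) / 2))
    (π : Measure (Fin p → Fin m → ℝ)) [IsProbabilityMeasure π]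
    (hπ : π = (∫⁻ M, ENNReal.ofReal (f M))⁻¹
        • volume.withDensity (fun M => ENNReal.ofReal (f M))) :
    ∫ M, (∑ i, ∑ j, (M i j) ^ 2) ∂π ≤ (p : ℝ) * m * τ ^ 2 := by
  by_cases hint : Integrable (fun M : Fin p → Fin m → ℝ => ∑ i, ∑ j, (M i j) ^ 2) π
  swap
  · rw [integral_undef hint]; positivity
  have mf := measurable_f τ f hf
  set Z := ∫⁻ M, ENNReal.ofReal (f M) with hZ
  have huniv : π Set.univ = 1 := measure_univ
  rw [hπ] at huniv
  simp only [Measure.smul_apply, withDensity_apply _ MeasurableSet.univ, Measure.restrict_univ,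
    smul_eq_mul, ← hZ] at huniv
  have hZ0 : Z ≠ 0 := by rintro h; simp [h] at huniv
  have hZt : Z ≠ ∞ := by rintro h; simp [h] at huniv
  have hl := hint.lintegral_lt_top
  rw [integral_eq_lintegral_of_nonneg_ae (Filter.Eventually.of_forall fun M => by positivity)
    hint.1]
  have e : ∫⁻ M, ENNReal.ofReal (∑ i, ∑ j, (M i j) ^ 2) ∂π
      = Z⁻¹ * ∫⁻ M, ENNReal.ofReal (∑ i, ∑ j, M i j ^ 2) * ENNReal.ofReal (f M) := by
    rw [hπ, lintegral_smul_measure, lintegral_withDensity_eq_lintegral_mul _ (by fun_prop)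
      (by fun_prop), smul_eq_mul]
    simp only [Pi.mul_apply, mul_comm]
  rw [e] at hl ⊢
  obtain ⟨n, rfl⟩ : ∃ n, p = n + 1 := ⟨p - 1, by omega⟩
  rw [total hm τ hτ f hf, ← hZ, mul_left_comm, huniv, mul_one, ENNReal.toReal_ofReal (by positivity)]
  intro h
  rw [h, ENNReal.mul_top (by simpa using hZt)] at hl
  exact lt_irrefl _ hl
end

section
/- Let π be the spectral scaled Student prior on ℝ^{p×k} with parameter τ > 0 and for any matrix M̄ ∈ ℝ^{p×k} let ρ_{M̄} be the translated distribution ρ_{M̄}(M) = π(M̄ − M). Then KL(ρ_{M̄}‖π) ≤ 2·rank(M̄)·(k+p+2)·log(1 + ‖M̄‖_F/(τ·√(2·rank(M̄)))), with the convention 0·log(1+0/0) = 0. -/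
open MeasureTheory Matrix Finset
open scoped ENNReal

lemma aux_spectral {k : ℕ} (N : Matrix (Fin k) (Fin k) ℝ) (hN : Nᵀ = N) :
    ∃ (Q : Matrix (Fin k) (Fin k) ℝ) (d : Fin k → ℝ), Qᵀ * Q = 1 ∧ Q * Qᵀ = 1 ∧
      Qᵀ * N * Q = diagonal d ∧ (univ.filter (fun i => d i ≠ 0)).card = N.rank := by
  have hH : N.IsHermitian := by
    rw [Matrix.IsHermitian, Matrix.conjTranspose_eq_transpose_of_trivial, hN]
  have h1 := Unitary.coe_star_mul_self hH.eigenvectorUnitary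
  have h2 := Unitary.coe_mul_star_self hH.eigenvectorUnitary
  have h3 := hH.conjStarAlgAut_star_eigenvectorUnitary
  rw [Unitary.conjStarAlgAut_star_apply] at h3
  rw [Unitary.coe_star] at h2
  rw [Matrix.star_eq_conjTranspose, Matrix.conjTranspose_eq_transpose_of_trivial] at h1 h2 h3
  refine ⟨hH.eigenvectorUnitary, hH.eigenvalues, h1, h2, ?_, ?_⟩
  · rw [h3]; rfl
  · rw [hH.rank_eq_card_non_zero_eigs, Fintype.card_subtype]

lemma aux_logdet {k : ℕ} (N : Matrix (Fin k) (Fin k) ℝ) (hN : Nᵀ = N) (hpos : (1 + N).PosDef)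
    (n : ℕ) (hr : N.rank ≤ n) (t : ℝ) (ht : 0 < t) :
    Real.log (1 + N).det ≤ n * (Real.log t + 1 / t - 1) + N.trace / t := by
  obtain ⟨Q, d, h1, h2, h3, h4⟩ := aux_spectral N hN
  have h5 : Qᵀ * (1 + N) * Q = diagonal (fun i => 1 + d i) := by
    rw [Matrix.mul_add, Matrix.add_mul, h3, Matrix.mul_one, h1, ← diagonal_one, diagonal_add]
  have h6 : (Qᵀ * (1 + N) * Q).PosDef := by
    rw [← Matrix.conjTranspose_eq_transpose_of_trivial]
    apply hpos.conjTranspose_mul_mul_same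
    intro x y hxy
    have := congrArg (fun z => Qᵀ *ᵥ z) hxy
    simpa [Matrix.mulVec_mulVec, h1] using this
  have h7 : ∀ i, 0 < 1 + d i := by
    intro i
    have := h6.diag_pos (i := i)
    rw [h5] at this
    simpa using this
  have h8 : (1 + N).det = ∏ i, (1 + d i) := by
    rw [← det_diagonal, ← h5, det_mul, det_mul, mul_right_comm, ← det_mul, h1, det_one, one_mul]
  have h9 : N.trace = ∑ i, d i := by
    rw [← trace_diagonal, ← h3, trace_mul_comm, ← Matrix.mul_assoc, h2, Matrix.one_mul]
  have hc : 0 ≤ Real.log t + 1 / t - 1 := by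
    have := Real.log_le_sub_one_of_pos (inv_pos.2 ht)
    rw [Real.log_inv] at this
    rw [one_div]; linarith
  rw [h8, Real.log_prod (fun i _ => (h7 i).ne'), h9]
  have h10 : ∀ i, Real.log (1 + d i) ≤
      (if d i ≠ 0 then (Real.log t + 1 / t - 1) else 0) + d i / t := by
    intro i
    split_ifs with h
    · have := Real.log_le_sub_one_of_pos (div_pos (h7 i) ht)
      rw [Real.log_div (h7 i).ne' ht.ne', add_div] at this
      linarith
    · push Not at h
      simp [h]
  calc _ ≤ _ := Finset.sum_le_sum (fun i _ => h10 i)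
    _ = N.rank * (Real.log t + 1 / t - 1) + (∑ i, d i) / t := by
      rw [Finset.sum_add_distrib, Finset.sum_div, ← Finset.sum_filter, Finset.sum_const, h4,
        nsmul_eq_mul]
    _ ≤ _ := by gcongr

lemma aux_trace {p k : ℕ} (τ : ℝ) (hτ : 0 < τ) (M B : Matrix (Fin p) (Fin k) ℝ)
    (G : Matrix (Fin k) (Fin k) ℝ) (hG : (τ ^ 2 • (1 : Matrix (Fin k) (Fin k) ℝ) + Mᵀ * M) * G = 1)
    (hGs : Gᵀ = G) (α : ℝ) (hα : 0 < α) :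
    ((Mᵀ * B + Bᵀ * M + Bᵀ * B) * G).trace ≤
      α * (B.rank / τ ^ 2) + (∑ i, ∑ j, B i j ^ 2) / α + (∑ i, ∑ j, B i j ^ 2) / τ ^ 2 := by
  obtain ⟨Q, d, h1, h2, h3, h4⟩ := aux_spectral (Bᵀ * B) (by simp)
  rw [rank_transpose_mul_self] at h4
  set Y := G * Q with hY
  set X := M * Y with hX
  set Z := B * Q with hZ
  have hZZ : Zᵀ * Z = diagonal d := by
    rw [← h3, hZ, transpose_mul]; simp only [Matrix.mul_assoc]
  have hXY : Xᵀ * X + τ ^ 2 • (Yᵀ * Y) = Yᵀ * Q := by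
    calc _ = Yᵀ * ((τ ^ 2 • (1 : Matrix (Fin k) (Fin k) ℝ) + Mᵀ * M) * G) * Q := by
          rw [hX, transpose_mul]
          simp only [Matrix.mul_assoc, ← hY, Matrix.add_mul, Matrix.mul_add, Matrix.smul_mul,
            Matrix.mul_smul, Matrix.one_mul]
          rw [add_comm]
      _ = _ := by rw [hG, Matrix.mul_one]
  have eX : ∀ j, ∑ i, X i j ^ 2 + τ ^ 2 * ∑ i, Y i j ^ 2 = ∑ i, Y i j * Q i j := by
    intro j
    have := congrFun (congrFun hXY j) j
    simpa [Matrix.mul_apply, Matrix.transpose_apply, ← sq] using this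
  have eQ : ∀ j, ∑ i, Q i j ^ 2 = 1 := by
    intro j
    have := congrFun (congrFun h1 j) j
    simpa [Matrix.mul_apply, Matrix.transpose_apply, ← sq] using this
  have eZ : ∀ j, ∑ i, Z i j ^ 2 = d j := by
    intro j
    have := congrFun (congrFun hZZ j) j
    simpa [Matrix.mul_apply, Matrix.transpose_apply, ← sq] using this
  have hs : ∀ j, ∑ i, Y i j * Q i j ≤ 1 / τ ^ 2 := by
    intro j
    have a1 : ∑ i, Y i j * Q i j ≤ ∑ i, (τ ^ 2 / 2 * Y i j ^ 2 + 1 / (2 * τ ^ 2) * Q i j ^ 2) := by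
      apply Finset.sum_le_sum
      intro i _
      have : τ ^ 2 / 2 * Y i j ^ 2 + 1 / (2 * τ ^ 2) * Q i j ^ 2 - Y i j * Q i j
        = (τ ^ 2 * Y i j - Q i j) ^ 2 / (2 * τ ^ 2) := by field_simp; ring
      have : 0 ≤ (τ ^ 2 * Y i j - Q i j) ^ 2 / (2 * τ ^ 2) := by positivity
      linarith
    rw [Finset.sum_add_distrib, ← Finset.mul_sum, ← Finset.mul_sum, eQ] at a1
    have a2 := eX j
    have a3 : 0 ≤ ∑ i, X i j ^ 2 := by positivity
    have a4 : 1 / (2 * τ ^ 2) * 1 = (1 / τ ^ 2) / 2 := by field_simp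
    linarith
  have hXs : ∀ j, ∑ i, X i j ^ 2 ≤ 1 / τ ^ 2 := by
    intro j
    have a2 := eX j
    have a3 : 0 ≤ τ ^ 2 * ∑ i, Y i j ^ 2 := by positivity
    linarith [hs j]
  have hb : ∑ i, ∑ j, B i j ^ 2 = ∑ j, d j := by
    calc _ = (Bᵀ * B).trace := by
          simp only [Matrix.trace, Matrix.diag, Matrix.mul_apply, Matrix.transpose_apply, ← sq]
          rw [Finset.sum_comm]
      _ = _ := by
          rw [← trace_diagonal d, ← h3, trace_mul_comm (Qᵀ * (Bᵀ * B)) Q, ← Matrix.mul_assoc, h2,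
            Matrix.one_mul]
  have hT1 : ((Bᵀ * M) * G).trace = ∑ j, ∑ i, Z i j * X i j := by
    calc _ = (Zᵀ * X).trace := by
          rw [hZ, hX, hY, transpose_mul, Matrix.mul_assoc Qᵀ, trace_mul_comm Qᵀ]
          simp only [Matrix.mul_assoc, h2, Matrix.mul_one]
      _ = _ := by simp only [Matrix.trace, Matrix.diag, Matrix.mul_apply, Matrix.transpose_apply]
  have hT2 : ((Mᵀ * B) * G).trace = ((Bᵀ * M) * G).trace := by
    rw [← trace_transpose, transpose_mul, transpose_mul, transpose_transpose, hGs, trace_mul_comm]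
  have hT3 : ((Bᵀ * B) * G).trace = ∑ j, d j * ∑ i, Y i j * Q i j := by
    have hB : Bᵀ * B = Q * diagonal d * Qᵀ := by
      rw [← h3]
      calc _ = (Q * Qᵀ) * (Bᵀ * B) * (Q * Qᵀ) := by rw [h2, Matrix.one_mul, Matrix.mul_one]
        _ = _ := by simp only [Matrix.mul_assoc]
    calc _ = (diagonal d * (Qᵀ * Y)).trace := by
          rw [hB, hY, Matrix.mul_assoc, Matrix.mul_assoc, trace_mul_comm Q]
          simp only [Matrix.mul_assoc]
      _ = _ := by
          simp only [Matrix.trace, Matrix.diag, Matrix.diagonal_mul]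
          simp only [Matrix.mul_apply, Matrix.transpose_apply]
          simp only [mul_comm (Q _ _)]
  rw [Matrix.add_mul, Matrix.add_mul, trace_add, trace_add, hT2, hT3, hT1, ← two_mul, hb]
  have hd : ∀ j, 0 ≤ d j := fun j => by rw [← eZ]; positivity
  have b1 : ∑ j, d j * ∑ i, Y i j * Q i j ≤ (∑ j, d j) / τ ^ 2 := by
    rw [Finset.sum_div]
    apply Finset.sum_le_sum
    intro j _
    calc _ ≤ d j * (1 / τ ^ 2) := mul_le_mul_of_nonneg_left (hs j) (hd j)
      _ = _ := by ring
  have b2 : ∀ j, 2 * ∑ i, Z i j * X i j ≤ (if d j ≠ 0 then α * (1 / τ ^ 2) else 0) + d j / α := by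
    intro j
    split_ifs with h
    · calc 2 * ∑ i, Z i j * X i j ≤ ∑ i, (α * X i j ^ 2 + Z i j ^ 2 / α) := by
            rw [Finset.mul_sum]
            apply Finset.sum_le_sum
            intro i _
            have : α * X i j ^ 2 + Z i j ^ 2 / α - 2 * (Z i j * X i j)
              = (α * X i j - Z i j) ^ 2 / α := by field_simp; ring
            have : 0 ≤ (α * X i j - Z i j) ^ 2 / α := by positivity
            linarith
        _ = α * ∑ i, X i j ^ 2 + d j / α := by
            rw [Finset.sum_add_distrib, ← Finset.mul_sum, ← Finset.sum_div, eZ]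
        _ ≤ _ := by gcongr; exact hXs j
    · push Not at h
      have hz : ∀ i, Z i j = 0 := by
        intro i
        have := eZ j
        rw [h, Finset.sum_eq_zero_iff_of_nonneg (fun i _ => sq_nonneg _)] at this
        simpa using this i (mem_univ _)
      simp [hz, h]
  have b3 := Finset.sum_le_sum (fun j (_ : j ∈ univ) => b2 j)
  rw [← Finset.mul_sum, Finset.sum_add_distrib, ← Finset.sum_filter, Finset.sum_const, h4,
    ← Finset.sum_div, nsmul_eq_mul] at b3
  have : (B.rank : ℝ) * (α * (1 / τ ^ 2)) = α * (B.rank / τ ^ 2) := by ring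
  linarith

lemma aux_rank_add {p k : ℕ} (A B : Matrix (Fin p) (Fin k) ℝ) :
    (A + B).rank ≤ A.rank + B.rank := by
  have h : LinearMap.range (A + B).mulVecLin ≤
      LinearMap.range A.mulVecLin ⊔ LinearMap.range B.mulVecLin := by
    rw [Matrix.mulVecLin_add]
    exact LinearMap.range_add_le _ _
  unfold Matrix.rank
  exact (Submodule.finrank_mono h).trans (Submodule.finrank_add_le_finrank_add_finrank _ _)

lemma aux_posDef {p k : ℕ} (τ : ℝ) (hτ : 0 < τ) (M : Matrix (Fin p) (Fin k) ℝ) :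
    (τ ^ 2 • (1 : Matrix (Fin k) (Fin k) ℝ) + Mᵀ * M).PosDef := by
  apply Matrix.PosDef.add_posSemidef
  · exact Matrix.PosDef.one.smul (by positivity)
  · rw [← Matrix.conjTranspose_eq_transpose_of_trivial]
    exact Matrix.posSemidef_conjTranspose_mul_self M

lemma aux_whiten {k : ℕ} (A : Matrix (Fin k) (Fin k) ℝ) (hA : A.PosDef) :
    ∃ R : Matrix (Fin k) (Fin k) ℝ, Rᵀ * A * R = 1 := by
  have hs : Aᵀ = A := by
    rw [← Matrix.conjTranspose_eq_transpose_of_trivial]; exact hA.1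
  obtain ⟨Q, d, h1, h2, h3, -⟩ := aux_spectral A hs
  have h6 : (Qᵀ * A * Q).PosDef := by
    rw [← Matrix.conjTranspose_eq_transpose_of_trivial]
    apply hA.conjTranspose_mul_mul_same
    intro x y hxy
    have := congrArg (fun z => Qᵀ *ᵥ z) hxy
    simpa [Matrix.mulVec_mulVec, h1] using this
  have h7 : ∀ i, 0 < d i := by
    intro i
    have := h6.diag_pos (i := i)
    rw [h3] at this
    simpa using this
  refine ⟨Q * diagonal (fun i => (Real.sqrt (d i))⁻¹), ?_⟩
  calc _ = diagonal (fun i => (Real.sqrt (d i))⁻¹) * (Qᵀ * A * Q) *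
        diagonal (fun i => (Real.sqrt (d i))⁻¹) := by
        rw [transpose_mul, diagonal_transpose]; simp only [Matrix.mul_assoc]
    _ = 1 := by
        rw [h3, diagonal_mul_diagonal, diagonal_mul_diagonal, ← diagonal_one]
        congr 1
        funext i
        have h8 : 0 < Real.sqrt (d i) := Real.sqrt_pos.2 (h7 i)
        have h9 := Real.mul_self_sqrt (h7 i).le
        field_simp
        nlinarith

lemma aux_det {p k : ℕ} (τ : ℝ) (hτ : 0 < τ) (M B : Matrix (Fin p) (Fin k) ℝ) :
    Real.log (τ ^ 2 • (1 : Matrix (Fin k) (Fin k) ℝ) + (M + B)ᵀ * (M + B)).det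
      - Real.log (τ ^ 2 • (1 : Matrix (Fin k) (Fin k) ℝ) + Mᵀ * M).det
      ≤ 4 * (B.rank : ℝ) * Real.log (1 + Real.sqrt (∑ i, ∑ j, (B i j) ^ 2)
          / (τ * Real.sqrt (2 * (B.rank : ℝ)))) := by
  by_cases hB : B = 0
  · subst hB; simp
  have hb : 0 < ∑ i, ∑ j, (B i j) ^ 2 := by
    have h0 : 0 ≤ ∑ i, ∑ j, (B i j) ^ 2 := by positivity
    rcases h0.lt_or_eq with h | h
    · exact h
    · exfalso
      apply hB
      ext i j
      have h1 := (Finset.sum_eq_zero_iff_of_nonneg (fun i _ =>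
        Finset.sum_nonneg (fun j _ => sq_nonneg (B i j)))).1 h.symm i (mem_univ _)
      have h2 := (Finset.sum_eq_zero_iff_of_nonneg (fun j _ => sq_nonneg (B i j))).1 h1 j
        (mem_univ _)
      simpa using h2
  have hr : 0 < (B.rank : ℝ) := by
    rw [Nat.cast_pos, Nat.pos_iff_ne_zero]
    intro h
    apply hB
    unfold Matrix.rank at h
    rw [Submodule.finrank_eq_zero, LinearMap.range_eq_bot] at h
    ext i j
    have := congrFun (LinearMap.congr_fun h (Pi.single j 1)) i
    simpa using this
  set r : ℝ := (B.rank : ℝ) with hrdef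
  set b2 := ∑ i, ∑ j, (B i j) ^ 2 with hb2
  set x := Real.sqrt b2 / (τ * Real.sqrt (2 * r)) with hx
  have hx0 : 0 < x := by positivity
  have hx2 : b2 = 2 * r * τ ^ 2 * x ^ 2 := by
    rw [hx, div_pow, mul_pow, Real.sq_sqrt hb.le, Real.sq_sqrt (by positivity)]
    field_simp
  set A := τ ^ 2 • (1 : Matrix (Fin k) (Fin k) ℝ) + Mᵀ * M with hA
  have hAp : A.PosDef := aux_posDef τ hτ M
  have hA'p := aux_posDef τ hτ (M + B)
  set N' := Mᵀ * B + Bᵀ * M + Bᵀ * B with hN'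
  have hAN : τ ^ 2 • (1 : Matrix (Fin k) (Fin k) ℝ) + (M + B)ᵀ * (M + B) = A + N' := by
    rw [hA, hN', transpose_add]
    simp only [Matrix.add_mul, Matrix.mul_add]
    abel
  rw [hAN] at hA'p ⊢
  obtain ⟨R, hR⟩ := aux_whiten A hAp
  have hG : A * (R * Rᵀ) = 1 := by
    rw [mul_eq_one_comm, Matrix.mul_assoc, mul_eq_one_comm]; exact hR
  have hdet : R.det * R.det * A.det = 1 := by
    have := congrArg Matrix.det hR
    rw [det_mul, det_mul, det_transpose, det_one] at this
    linarith
  have hH : Rᵀ * (A + N') * R = 1 + Rᵀ * N' * R := by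
    rw [Matrix.mul_add, Matrix.add_mul, hR]
  have hNs : (Rᵀ * N' * R)ᵀ = Rᵀ * N' * R := by
    have : N'ᵀ = N' := by
      rw [hN']; simp only [transpose_add, transpose_mul, transpose_transpose]; abel
    rw [transpose_mul, transpose_mul, this, transpose_transpose, Matrix.mul_assoc]
  have hHp : (1 + Rᵀ * N' * R).PosDef := by
    rw [← hH, ← Matrix.conjTranspose_eq_transpose_of_trivial]
    apply hA'p.conjTranspose_mul_mul_same
    intro u v huv
    have := congrArg (fun z => (Rᵀ * A) *ᵥ z) huv
    simpa [Matrix.mulVec_mulVec, hR] using this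
  have hrank : (Rᵀ * N' * R).rank ≤ 2 * B.rank := by
    have e : N' = (Mᵀ + Bᵀ) * B + Bᵀ * M := by
      rw [hN', Matrix.add_mul]; abel
    calc _ ≤ (Rᵀ * N').rank := rank_mul_le_left _ _
      _ ≤ N'.rank := rank_mul_le_right _ _
      _ ≤ ((Mᵀ + Bᵀ) * B).rank + (Bᵀ * M).rank := by rw [e]; exact aux_rank_add _ _
      _ ≤ B.rank + Bᵀ.rank := add_le_add (rank_mul_le_right _ _) (rank_mul_le_left _ _)
      _ = _ := by rw [rank_transpose]; ring
  have hlog := aux_logdet _ hNs hHp _ hrank ((1 + x) ^ 2) (by positivity)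
  have htr := aux_trace τ hτ M B (R * Rᵀ) hG (by simp) (τ ^ 2 * x) (by positivity)
  rw [← Matrix.mul_assoc, trace_mul_comm, ← Matrix.mul_assoc, ← hN', ← hb2, ← hrdef] at htr
  have hT : (Rᵀ * N' * R).trace ≤ 2 * r * ((1 + x) ^ 2 - 1) := by
    have e1 : τ ^ 2 * x * (r / τ ^ 2) + b2 / (τ ^ 2 * x) + b2 / τ ^ 2
        = 3 * r * x + 2 * r * x ^ 2 := by
      rw [hx2]; field_simp; ring
    have : 0 < r * x := by positivity
    nlinarith
  have hRd : R.det ≠ 0 := by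
    intro h; rw [h] at hdet; simp at hdet
  have hA0 : 0 < A.det := hAp.det_pos
  have hA1 : 0 < (A + N').det := hA'p.det_pos
  have hl : Real.log (1 + Rᵀ * N' * R).det = Real.log (A + N').det - Real.log A.det := by
    rw [← Real.log_div hA1.ne' hA0.ne', ← hH, det_mul, det_mul, det_transpose]
    congr 1
    rw [eq_div_iff hA0.ne']
    linear_combination (A + N').det * hdet
  rw [← hl]
  refine hlog.trans ?_
  rw [Real.log_pow]
  have h2 : (Rᵀ * N' * R).trace / (1 + x) ^ 2 ≤ 2 * r * ((1 + x) ^ 2 - 1) / (1 + x) ^ 2 := by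
    gcongr
  have h3 : 2 * r * ((1 + x) ^ 2 - 1) / (1 + x) ^ 2 = 2 * r * (1 - 1 / (1 + x) ^ 2) := by
    field_simp
  push_cast
  rw [← hrdef]
  linarith

/-- **KL bound for the translated scaled Student prior** (Dalalyan, Lemma 2):
if `π` is the spectral scaled Student prior on `p × k` matrices with
parameter `τ > 0` and `ρ_{M̄}` is its translation by `M̄` (i.e. the image of
`π` under `M ↦ M̄ − M`), then
`KL(ρ_{M̄}‖π) ≤ 2 rank(M̄) (k+p+2) log(1 + ‖M̄‖_F / (τ √(2 rank(M̄))))`,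
with the convention `0 · log(1 + 0/0) = 0`. -/
theorem scaled_student_translation_kl_bound
    {p k : ℕ} (hp : 0 < p) (hk : 0 < k) (τ : ℝ) (hτ : 0 < τ)
    (f : (Fin p → Fin k → ℝ) → ℝ)
    (hf : ∀ M, f M = Matrix.det (τ ^ 2 • (1 : Matrix (Fin k) (Fin k) ℝ)
        + (Matrix.of M)ᵀ * Matrix.of M) ^ (-((p : ℝ) + k + 2) / 2))
    (π : Measure (Fin p → Fin k → ℝ)) [IsProbabilityMeasure π]
    (hπ : π = (∫⁻ M, ENNReal.ofReal (f M))⁻¹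
        • volume.withDensity (fun M => ENNReal.ofReal (f M)))
    (Mbar : Fin p → Fin k → ℝ)
    (ρ : Measure (Fin p → Fin k → ℝ))
    (hρ : ρ = π.map (fun M => Mbar - M)) :
    ∫ M, Real.log ((ρ.rnDeriv π M).toReal) ∂ρ
      ≤ 2 * ((Matrix.of Mbar).rank : ℝ) * ((k : ℝ) + p + 2) *
        Real.log (1 + Real.sqrt (∑ i, ∑ j, (Mbar i j) ^ 2)
          / (τ * Real.sqrt (2 * ((Matrix.of Mbar).rank : ℝ)))) := by
  set C := 2 * ((Matrix.of Mbar).rank : ℝ) * ((k : ℝ) + p + 2) *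
        Real.log (1 + Real.sqrt (∑ i, ∑ j, (Mbar i j) ^ 2)
          / (τ * Real.sqrt (2 * ((Matrix.of Mbar).rank : ℝ)))) with hC
  have hC0 : 0 ≤ C := by
    have : 0 ≤ Real.log (1 + Real.sqrt (∑ i, ∑ j, (Mbar i j) ^ 2)
          / (τ * Real.sqrt (2 * ((Matrix.of Mbar).rank : ℝ)))) := by
      apply Real.log_nonneg
      have : 0 ≤ Real.sqrt (∑ i, ∑ j, (Mbar i j) ^ 2)
          / (τ * Real.sqrt (2 * ((Matrix.of Mbar).rank : ℝ))) := by positivity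
      linarith
    positivity
  have hdet : ∀ M : Fin p → Fin k → ℝ, 0 < Matrix.det (τ ^ 2 • (1 : Matrix (Fin k) (Fin k) ℝ)
        + (Matrix.of M)ᵀ * Matrix.of M) := fun M => (aux_posDef τ hτ (Matrix.of M)).det_pos
  have hfpos : ∀ M, 0 < f M := fun M => by
    rw [hf]; exact Real.rpow_pos_of_pos (hdet M) _
  have hfm : Measurable f := by
    have h1 : Continuous (fun M : Fin p → Fin k → ℝ =>
        Matrix.det (τ ^ 2 • (1 : Matrix (Fin k) (Fin k) ℝ)
        + (Matrix.of M)ᵀ * Matrix.of M)) := by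
      have h2 : Continuous (fun M : Fin p → Fin k → ℝ => Matrix.of M) := continuous_id
      exact (continuous_const.add (h2.matrix_transpose.matrix_mul h2)).matrix_det
    have : f = fun M => Matrix.det (τ ^ 2 • (1 : Matrix (Fin k) (Fin k) ℝ)
        + (Matrix.of M)ᵀ * Matrix.of M) ^ (-((p : ℝ) + k + 2) / 2) := funext hf
    rw [this]
    exact h1.measurable.pow_const _
  have hsub : Measurable (fun M : Fin p → Fin k → ℝ => Mbar - M) := by fun_prop
  have hFm : Measurable (fun M => ENNReal.ofReal (f M)) := hfm.ennreal_ofReal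
  set g : (Fin p → Fin k → ℝ) → ℝ≥0∞ := fun M => ENNReal.ofReal (f (Mbar - M) / f M) with hg
  have hgm : Measurable g := ((hfm.comp hsub).div hfm).ennreal_ofReal
  have hρg : ρ = π.withDensity g := by
    have e1 : (fun M => ENNReal.ofReal (f M)) * g = fun M => ENNReal.ofReal (f (Mbar - M)) := by
      funext M
      simp only [hg, Pi.mul_apply]
      rw [← ENNReal.ofReal_mul (hfpos M).le, mul_div_cancel₀ _ (hfpos M).ne']
    have e2 : (volume.withDensity (fun M => ENNReal.ofReal (f M))).map (fun M => Mbar - M)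
        = volume.withDensity (fun M => ENNReal.ofReal (f (Mbar - M))) := by
      have hmp : MeasurePreserving (fun M : Fin p → Fin k → ℝ => Mbar - M) volume volume :=
        Measure.measurePreserving_sub_left volume Mbar
      ext s hs
      rw [Measure.map_apply hsub hs, withDensity_apply _ (hsub hs), withDensity_apply _ hs]
      rw [← (hmp.restrict_preimage (hsub hs)).lintegral_comp hFm]
      congr 2
      ext M
      simp
    rw [hρ, hπ, Measure.map_smul, withDensity_smul_measure, e2, ← withDensity_mul _ hFm hgm, e1]
  have hprob : IsProbabilityMeasure ρ := by
    rw [hρ]; exact Measure.isProbabilityMeasure_map hsub.aemeasurable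
  have hac : ρ ≪ π := by rw [hρg]; exact withDensity_absolutelyContinuous _ _
  have hrn : ρ.rnDeriv π =ᵐ[ρ] g := by
    apply hac.ae_le
    rw [hρg]
    exact Measure.rnDeriv_withDensity π hgm
  have hbound : ∀ M, Real.log (g M).toReal ≤ C := by
    intro M
    simp only [hg]
    rw [ENNReal.toReal_ofReal (div_nonneg (hfpos _).le (hfpos _).le),
      Real.log_div (hfpos _).ne' (hfpos _).ne', hf, hf, Real.log_rpow (hdet _),
      Real.log_rpow (hdet _)]
    have h := aux_det τ hτ (Matrix.of M - Matrix.of Mbar) (Matrix.of Mbar)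
    have e : (Matrix.of (Mbar - M))ᵀ * Matrix.of (Mbar - M) =
        (Matrix.of M - Matrix.of Mbar)ᵀ * (Matrix.of M - Matrix.of Mbar) := by
      have : Matrix.of (Mbar - M) = -(Matrix.of M - Matrix.of Mbar) := by
        ext i j; simp
      rw [this, transpose_neg, Matrix.neg_mul, Matrix.mul_neg, neg_neg]
    rw [sub_add_cancel] at h
    rw [e, hC]
    simp only [Matrix.of_apply] at h
    have hn : 0 ≤ ((p : ℝ) + k + 2) / 2 := by positivity
    have := mul_le_mul_of_nonneg_left h hn
    linarith
  by_cases hint : Integrable (fun M => Real.log ((ρ.rnDeriv π M).toReal)) ρ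
  · calc _ ≤ ∫ _, C ∂ρ := by
          apply integral_mono_ae hint (integrable_const C)
          filter_upwards [hrn] with M hM
          rw [hM]; exact hbound M
      _ = C := by simp
  · rw [integral_undef hint]; exact hC0
end
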